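/- Assume the mastery hypotheses, and additionally that all non-terminal rewards are non-positive: R(s, a, T(s, a)) ≤ 0 whenever s ∉ Abs and T(s, a) ∉ Abs. Then for every g ∈ G with g ∉ Abs, V̄*(g, g) = Rterm(g), where Rterm(g) is the supremum over {a ∈ A : T(g, a) ∈ Abs} of R(g, a, T(g, a)). -/

import Mathlib

open Classical

/-- The state reached after `i` steps when starting in `s` and executing the actions in `as`
(deterministic transition function `T`). `stateAt T s as 0 = s` and
`stateAt T s as (i+1) = T (stateAt T s as i) (as[i])`. -/
def stateAt {S A : Type*} (T : S → A → S) (s : S) (as : List A) (i : ℕ) : S :=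
  (as.take i).foldl T s

/-- `as` is a terminating trajectory from `s`: it is nonempty, the final induced state is
absorbing, and no earlier induced state is absorbing. -/
def Terminating {S A : Type*} (T : S → A → S) (Abs : Set S) (s : S) (as : List A) : Prop :=
  as ≠ [] ∧ stateAt T s as as.length ∈ Abs ∧ ∀ i < as.length, stateAt T s as i ∉ Abs

/-- The achieved goal of a trajectory: the state from which the terminal transition is taken. -/
def achievedGoal {S A : Type*} (T : S → A → S) (s : S) (as : List A) : S :=
  stateAt T s as (as.length - 1)

/-- The return of a trajectory under reward function `R`: the sum of the one-step rewards. -/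
def ret {S A : Type*} (T : S → A → S) (R : S → A → S → ℝ) : S → List A → ℝ
  | _, [] => 0
  | s, a :: as => R s a (T s a) + ret T R (T s a) as

/-- The internal goal set: all states from which some action leads to an absorbing state. -/
def goalSet {S A : Type*} (T : S → A → S) (Abs : Set S) : Set S :=
  {s | ∃ a : A, T s a ∈ Abs}

/-- The goal-oriented reward: a penalty `rbMIN` for terminal transitions taken from a state
other than the goal `g`, and the task reward `R` otherwise. -/
noncomputable def Rbar {S A : Type*} (Abs : Set S) (rbMIN : ℝ) (R : S → A → S → ℝ) (g : S) :
    S → A → S → ℝ :=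
  fun s a s' => if s ≠ g ∧ s' ∈ Abs then rbMIN else R s a s'

/-- The optimal value `Q*(s, a)`: the supremum of returns under `R` over terminating
trajectories from `s` whose first action is `a`. -/
noncomputable def Qstar {S A : Type*} (T : S → A → S) (Abs : Set S) (R : S → A → S → ℝ)
    (s : S) (a : A) : ℝ :=
  sSup {x | ∃ as : List A, Terminating T Abs s as ∧ as.head? = some a ∧ ret T R s as = x}

/-- The optimal state value `V*(s) = sup_a Q*(s, a)`. -/
noncomputable def Vstar {S A : Type*} (T : S → A → S) (Abs : Set S) (R : S → A → S → ℝ)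
    (s : S) : ℝ :=
  sSup (Set.range (Qstar T Abs R s))

/-- The optimal world value `Q̄*(s, g, a)`: the optimal value for the goal-oriented reward. -/
noncomputable def Qbar {S A : Type*} (T : S → A → S) (Abs : Set S) (rbMIN : ℝ)
    (R : S → A → S → ℝ) (s g : S) (a : A) : ℝ :=
  Qstar T Abs (Rbar Abs rbMIN R g) s a

/-- The optimal world state value `V̄*(s, g) = sup_a Q̄*(s, g, a)`. -/
noncomputable def Vbar {S A : Type*} (T : S → A → S) (Abs : Set S) (rbMIN : ℝ)
    (R : S → A → S → ℝ) (s g : S) : ℝ :=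
  sSup (Set.range (Qbar T Abs rbMIN R s g))

/-- The environment is proper with horizon `D`: from every non-absorbing state some
terminating trajectory exists, and every terminating trajectory has length at most `D`. -/
def Proper {S A : Type*} (T : S → A → S) (Abs : Set S) (D : ℕ) : Prop :=
  1 ≤ D ∧ (∀ s ∉ Abs, ∃ as : List A, Terminating T Abs s as) ∧
    ∀ (s : S) (as : List A), Terminating T Abs s as → as.length ≤ D

/-- `g` is reachable from `s`: some terminating trajectory from `s` has achieved goal `g`. -/
def Reachable {S A : Type*} (T : S → A → S) (Abs : Set S) (s g : S) : Prop :=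
  ∃ as : List A, Terminating T Abs s as ∧ achievedGoal T s as = g

/-- The optimal terminal reward at a goal state `g`: the supremum of `R(g, a, T(g, a))`
over actions `a` whose transition from `g` is terminal. -/
noncomputable def Rterm {S A : Type*} (T : S → A → S) (Abs : Set S) (R : S → A → S → ℝ)
    (g : S) : ℝ :=
  sSup {x | ∃ a : A, T g a ∈ Abs ∧ R g a (T g a) = x}

theorem terminating_nil {S A : Type*} {T : S → A → S} {Abs : Set S} {s : S} :
    ¬ Terminating T Abs s [] := fun h => h.1 rfl

theorem terminating_single {S A : Type*} {T : S → A → S} {Abs : Set S} {s : S} {a : A}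
    (hs : s ∉ Abs) (h : T s a ∈ Abs) : Terminating T Abs s [a] := by
  refine ⟨by simp, by simpa [stateAt] using h, ?_⟩
  intro i hi
  have : i = 0 := by simpa using hi
  subst this
  simpa [stateAt] using hs

theorem terminating_cons {S A : Type*} {T : S → A → S} {Abs : Set S} {s : S} {a : A}
    {as : List A} (hs : s ∉ Abs) (h : Terminating T Abs (T s a) as) :
    Terminating T Abs s (a :: as) := by
  refine ⟨by simp, by simpa [stateAt] using h.2.1, ?_⟩
  intro i hi
  cases i with
  | zero => simpa [stateAt] using hs
  | succ i =>
    have := h.2.2 i (by simpa using hi)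
    simpa [stateAt] using this

theorem terminating_cons_inv {S A : Type*} {T : S → A → S} {Abs : Set S} {s : S} {a : A}
    {as : List A} (h : Terminating T Abs s (a :: as)) :
    s ∉ Abs ∧ ((as = [] ∧ T s a ∈ Abs) ∨ (T s a ∉ Abs ∧ Terminating T Abs (T s a) as)) := by
  obtain ⟨-, h2, h3⟩ := h
  refine ⟨by simpa [stateAt] using h3 0 (by simp), ?_⟩
  cases as with
  | nil => left; exact ⟨rfl, by simpa [stateAt] using h2⟩
  | cons b bs =>
    right
    refine ⟨by simpa [stateAt] using h3 1 (by simp), by simp, by simpa [stateAt] using h2, ?_⟩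
    intro i hi
    have := h3 (i + 1) (by simpa using hi)
    simpa [stateAt] using this

theorem ret_rbar_le {S A : Type*} (T : S → A → S) (Abs : Set S)
    (R : S → A → S → ℝ) (rbMIN M : ℝ) (g : S) (hM : rbMIN ≤ M)
    (hg : ∀ a, T g a ∈ Abs → R g a (T g a) ≤ M)
    (hnonpos : ∀ s ∉ Abs, ∀ a : A, T s a ∉ Abs → R s a (T s a) ≤ 0) (as : List A) :
    ∀ s, Terminating T Abs s as → ret T (Rbar Abs rbMIN R g) s as ≤ M := by
  induction as with
  | nil => intro s h; exact absurd h terminating_nil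
  | cons a as ih =>
    intro s h
    obtain ⟨hs, ⟨rfl, ht⟩ | ⟨ht, h'⟩⟩ := terminating_cons_inv h
    · by_cases hsg : s = g
      · subst hsg
        simpa [ret, Rbar] using hg a ht
      · simpa [ret, Rbar, hsg, ht] using hM
    · have h1 := ih _ h'
      have h2 := hnonpos s hs a ht
      have h3 : Rbar Abs rbMIN R g s a (T s a) = R s a (T s a) := by simp [Rbar, ht]
      simp only [ret, h3]
      linarith

/-- The `g = s` case of **Theorem 4(i)**: under the mastery hypotheses, if additionally all
non-terminal rewards are non-positive, then at any non-absorbing goal state `g ∈ G`, the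
optimal world value of the goal itself is the optimal terminal reward: `V̄*(g, g) = Rterm(g)`. -/
theorem vbar_self_eq_rterm {S A : Type*} (T : S → A → S) (Abs : Set S)
    (R : S → A → S → ℝ) (rMIN rMAX rbMIN : ℝ) (D : ℕ)
    (hProper : Proper T Abs D)
    (hbound : ∀ s ∉ Abs, ∀ a : A, rMIN ≤ R s a (T s a) ∧ R s a (T s a) < rMAX)
    (hrMIN : rMIN ≤ 0) (hrMAX : 0 < rMAX)
    (hrb : rbMIN = (rMIN - rMAX) * D)
    (hnonpos : ∀ s ∉ Abs, ∀ a : A, T s a ∉ Abs → R s a (T s a) ≤ 0) :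
    ∀ g ∈ goalSet T Abs, g ∉ Abs →
      Vbar T Abs rbMIN R g g = Rterm T Abs R g := by
  intro g hgG hgA
  obtain ⟨hD, hex, -⟩ := hProper
  have hbddR : BddAbove {x | ∃ a : A, T g a ∈ Abs ∧ R g a (T g a) = x} := by
    refine ⟨rMAX, ?_⟩
    rintro x ⟨a, -, rfl⟩
    exact (hbound g hgA a).2.le
  have hg : ∀ a, T g a ∈ Abs → R g a (T g a) ≤ Rterm T Abs R g :=
    fun a ha => le_csSup hbddR ⟨a, ha, rfl⟩
  obtain ⟨a₀, ha₀⟩ := hgG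
  have hM : rbMIN ≤ Rterm T Abs R g := by
    have h1 := hg a₀ ha₀
    have h2 := (hbound g hgA a₀).1
    have h3 : (1 : ℝ) ≤ D := by exact_mod_cast hD
    nlinarith
  have hret := ret_rbar_le T Abs R rbMIN _ g hM hg hnonpos
  have hQ : ∀ a, Qbar T Abs rbMIN R g g a ≤ Rterm T Abs R g := by
    intro a
    apply csSup_le
    · by_cases ha : T g a ∈ Abs
      · exact ⟨_, [a], terminating_single hgA ha, rfl, rfl⟩
      · obtain ⟨as, has⟩ := hex _ ha
        exact ⟨_, a :: as, terminating_cons hgA has, rfl, rfl⟩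
    · rintro x ⟨as, has, -, rfl⟩
      exact hret as g has
  apply le_antisymm
  · refine csSup_le (Set.nonempty_of_mem ⟨a₀, rfl⟩) ?_
    rintro x ⟨a, rfl⟩
    exact hQ a
  · refine csSup_le (Set.nonempty_of_mem ⟨a₀, ha₀, rfl⟩) ?_
    rintro x ⟨a, ha, rfl⟩
    have h1 : R g a (T g a) ≤ Qbar T Abs rbMIN R g g a := by
      apply le_csSup
      · refine ⟨Rterm T Abs R g, ?_⟩
        rintro x ⟨as, has, -, rfl⟩
        exact hret as g has
      · exact ⟨[a], terminating_single hgA ha, rfl, by simp [ret, Rbar]⟩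
    refine h1.trans (le_csSup ⟨Rterm T Abs R g, ?_⟩ ⟨a, rfl⟩)
    rintro x ⟨b, rfl⟩
    exact hQ b
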